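/- Let K be a field of characteristic 0, let 𝒜 be a full rank supersolvable line arrangement in ℙ²(K) with m := m(𝒜) ≥ 3, let P ∈ Sing(𝒜) be a point of multiplicity m (hence modular), and let 𝒜_h be the subarrangement of the lines of 𝒜 not passing through P. Then |Sing₂(𝒜)| = |Sing(𝒜)| − |Sing(𝒜_h)| − 1. -/

import Mathlib

open scoped Classical

/-- A point of the projective plane over `K`. -/
abbrev Pt (K : Type*) [Field K] := Projectivization K (Fin 3 → K)

/-- A (candidate) line arrangement: a finite set of linear subspaces of `K³`. -/
abbrev Arr (K : Type*) [Field K] := Finset (Submodule K (Fin 3 → K))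

/-- Every member of `A` is a projective line, i.e. a 2-dimensional linear subspace of `K³`. -/
def IsLineArr {K : Type*} [Field K] (A : Arr K) : Prop :=
  ∀ L ∈ A, Module.finrank K L = 2

/-- The multiplicity `m(P, A)`: the number of lines of `A` passing through `P`. -/
noncomputable def multAt {K : Type*} [Field K] (A : Arr K) (P : Pt K) : ℕ :=
  (A.filter fun L => P.submodule ≤ L).card

/-- `Sing(A)`: the set of points lying on at least two lines of `A`. -/
def SingSet {K : Type*} [Field K] (A : Arr K) : Set (Pt K) :=
  {P | 2 ≤ multAt A P}

/-- `Sing₂(A)`: the set of simple points, i.e. singular points of multiplicity exactly 2. -/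
def Sing2Set {K : Type*} [Field K] (A : Arr K) : Set (Pt K) :=
  {P | multAt A P = 2}

/-- `m(A)`: the maximum multiplicity of a singular point of `A`. -/
noncomputable def maxMult {K : Type*} [Field K] (A : Arr K) : ℕ :=
  sSup (multAt A '' SingSet A)

/-- `P` is a modular point of `A`: it is singular, and for every other singular point `Q`
the line through `P` and `Q` belongs to `A`. -/
def IsModular {K : Type*} [Field K] (A : Arr K) (P : Pt K) : Prop :=
  P ∈ SingSet A ∧ ∀ Q ∈ SingSet A, Q ≠ P → (P.submodule ⊔ Q.submodule) ∈ A

/-- `A` is supersolvable: it has a modular point. -/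
def Supersolvable {K : Type*} [Field K] (A : Arr K) : Prop :=
  ∃ P, IsModular A P

/-- `A` has full rank (rank 3): its lines have no common point. -/
def FullRank {K : Type*} [Field K] (A : Arr K) : Prop :=
  (⨅ L ∈ A, L) = ⊥

section ProjectivePlane

variable {K : Type*} [Field K]

lemma Pt.finrank_sup {P Q : Pt K} (h : P ≠ Q) :
    Module.finrank K ↥(P.submodule ⊔ Q.submodule) = 2 := by
  have h1 := Submodule.finrank_sup_add_finrank_inf_eq P.submodule Q.submodule
  have hP := P.finrank_submodule
  have hQ := Q.finrank_submodule
  have h0 : Module.finrank K ↥(P.submodule ⊓ Q.submodule) = 0 := by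
    by_contra h0
    have hle : Module.finrank K ↥(P.submodule ⊓ Q.submodule) ≤ 1 :=
      hP ▸ Submodule.finrank_mono inf_le_left
    have e1 : P.submodule ⊓ Q.submodule = P.submodule :=
      Submodule.eq_of_le_of_finrank_eq inf_le_left (by omega)
    have e2 : P.submodule ⊓ Q.submodule = Q.submodule :=
      Submodule.eq_of_le_of_finrank_eq inf_le_right (by omega)
    exact h (Projectivization.submodule_injective (e1.symm.trans e2))
  omega

lemma Pt.sup_eq_line {P Q : Pt K} (h : P ≠ Q) {L : Submodule K (Fin 3 → K)}
    (hL : Module.finrank K L = 2) (hP : P.submodule ≤ L) (hQ : Q.submodule ≤ L) :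
    P.submodule ⊔ Q.submodule = L :=
  Submodule.eq_of_le_of_finrank_eq (sup_le hP hQ) (by rw [Pt.finrank_sup h, hL])

lemma Pt.eq_of_le_lines {P Q : Pt K} {L M : Submodule K (Fin 3 → K)}
    (hL : Module.finrank K L = 2) (hM : Module.finrank K M = 2) (hLM : L ≠ M)
    (hPL : P.submodule ≤ L) (hPM : P.submodule ≤ M)
    (hQL : Q.submodule ≤ L) (hQM : Q.submodule ≤ M) : P = Q := by
  by_contra h
  exact hLM ((Pt.sup_eq_line h hL hPL hQL).symm.trans (Pt.sup_eq_line h hM hPM hQM))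

lemma exists_pt_le_lines {L M : Submodule K (Fin 3 → K)}
    (hL : Module.finrank K L = 2) (hM : Module.finrank K M = 2) :
    ∃ X : Pt K, X.submodule ≤ L ∧ X.submodule ≤ M := by
  have h1 := Submodule.finrank_sup_add_finrank_inf_eq L M
  have h2 : Module.finrank K ↥(L ⊔ M) ≤ 3 := by
    simpa using Submodule.finrank_le (L ⊔ M)
  have h3 : L ⊓ M ≠ ⊥ := by
    intro h
    rw [h, finrank_bot] at h1
    omega
  obtain ⟨v, hv, hv0⟩ := Submodule.exists_mem_ne_zero_of_ne_bot h3
  refine ⟨Projectivization.mk K v hv0, ?_, ?_⟩ <;>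
    rw [Projectivization.submodule_mk, Submodule.span_singleton_le_iff_mem]
  exacts [hv.1, hv.2]

lemma mem_singSet_iff {A : Arr K} {P : Pt K} :
    P ∈ SingSet A ↔
      ∃ L ∈ A, ∃ M ∈ A, P.submodule ≤ L ∧ P.submodule ≤ M ∧ L ≠ M := by
  change 1 < (A.filter fun L => P.submodule ≤ L).card ↔ _
  rw [Finset.one_lt_card]
  simp only [Finset.mem_filter]
  constructor
  · rintro ⟨L, ⟨hL, hPL⟩, M, ⟨hM, hPM⟩, h⟩
    exact ⟨L, hL, M, hM, hPL, hPM, h⟩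
  · rintro ⟨L, hL, M, hM, hPL, hPM, h⟩
    exact ⟨L, ⟨hL, hPL⟩, M, ⟨hM, hPM⟩, h⟩

lemma singSet_finite {A : Arr K} (hA : IsLineArr A) : (SingSet A).Finite := by
  have hsub : ∀ P ∈ SingSet A, ∃ p ∈ A ×ˢ A, P.submodule ≤ p.1 ∧ P.submodule ≤ p.2 ∧
      p.1 ≠ p.2 := by
    intro P hP
    obtain ⟨L, hL, M, hM, h⟩ := mem_singSet_iff.1 hP
    exact ⟨(L, M), Finset.mem_product.2 ⟨hL, hM⟩, h⟩
  choose! f hf hf1 hf2 hne using hsub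
  refine Set.Finite.of_finite_image ((A ×ˢ A).finite_toSet.subset ?_) (f := f) ?_
  · rintro _ ⟨P, hP, rfl⟩
    exact hf P hP
  · intro P hP Q hQ hPQ
    have hp := Finset.mem_product.1 (hf P hP)
    exact Pt.eq_of_le_lines (hA _ hp.1) (hA _ hp.2) (hne P hP) (hf1 P hP) (hf2 P hP)
      (hPQ ▸ hf1 Q hQ) (hPQ ▸ hf2 Q hQ)

lemma multAt_le_maxMult {A : Arr K} {P : Pt K} (hP : P ∈ SingSet A) :
    multAt A P ≤ maxMult A := by
  refine le_csSup ⟨A.card, ?_⟩ ⟨P, hP, rfl⟩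
  rintro _ ⟨Q, -, rfl⟩
  exact Finset.card_filter_le _ _

/-- A singular point which is not modular has smaller multiplicity than any modular point. -/
lemma IsModular.multAt_lt {A : Arr K} (hA : IsLineArr A) {P Q : Pt K} (hQ : IsModular A Q)
    (hP : P ∈ SingSet A) (hPn : ¬ IsModular A P) : multAt A P < multAt A Q := by
  have hPQ : P ≠ Q := fun h => hPn (h ▸ hQ)
  obtain ⟨R, hR, hRP, hPR⟩ : ∃ R ∈ SingSet A, R ≠ P ∧ P.submodule ⊔ R.submodule ∉ A := by
    by_contra! h
    exact hPn ⟨hP, h⟩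
  have hRQ : R ≠ Q := by
    rintro rfl
    exact hPR (sup_comm P.submodule R.submodule ▸ hQ.2 P hP hPQ)
  obtain ⟨L, hL, hRL, hQL⟩ : ∃ L ∈ A, R.submodule ≤ L ∧ ¬ Q.submodule ≤ L := by
    obtain ⟨L, hL, M, hM, hRL, hRM, hLM⟩ := mem_singSet_iff.1 hR
    by_contra! h
    exact hRQ (Pt.eq_of_le_lines (hA L hL) (hA M hM) hLM hRL hRM (h L hL hRL) (h M hM hRM))
  have hPL : ¬ P.submodule ≤ L := fun h =>
    hPR (Pt.sup_eq_line hRP.symm (hA L hL) h hRL ▸ hL)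
  have hX : ∀ M ∈ A.filter fun M => P.submodule ≤ M,
      ∃ X : Pt K, X.submodule ≤ L ∧ X.submodule ≤ M := fun M hM =>
    exists_pt_le_lines (hA L hL) (hA M (Finset.mem_filter.1 hM).1)
  choose! x hxL hxM using hX
  have hne : ∀ X : Pt K, X.submodule ≤ L → X ≠ Q := by
    rintro X hX rfl
    exact hQL hX
  have hmem : ∀ X ∈ SingSet A, X.submodule ≤ L →
      Q.submodule ⊔ X.submodule ∈ A.filter fun M => Q.submodule ≤ M := fun X hX hXL =>
    Finset.mem_filter.2 ⟨hQ.2 X hX (hne X hXL), le_sup_left⟩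
  have hinj : ∀ X Y : Pt K, X.submodule ≤ L → Y.submodule ≤ L →
      Q.submodule ⊔ X.submodule = Q.submodule ⊔ Y.submodule → X = Y := by
    intro X Y hXL hYL h
    exact Pt.eq_of_le_lines (hA L hL) (Pt.finrank_sup (hne X hXL).symm)
      (fun e => hQL (e ▸ le_sup_left)) hXL le_sup_right hYL (h ▸ le_sup_right)
  have hxS : ∀ M ∈ A.filter fun M => P.submodule ≤ M, x M ∈ SingSet A := fun M hM =>
    mem_singSet_iff.2 ⟨L, hL, M, (Finset.mem_filter.1 hM).1, hxL M hM, hxM M hM,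
      fun e => hPL (e ▸ (Finset.mem_filter.1 hM).2)⟩
  have hxP : ∀ M ∈ A.filter fun M => P.submodule ≤ M, P.submodule ⊔ (x M).submodule = M := by
    intro M hM
    refine Pt.sup_eq_line ?_ (hA M (Finset.mem_filter.1 hM).1) (Finset.mem_filter.1 hM).2
      (hxM M hM)
    intro e
    exact hPL (e ▸ hxL M hM)
  have hcard : ((A.filter fun M => P.submodule ≤ M).image
      fun M => Q.submodule ⊔ (x M).submodule).card = multAt A P := by
    refine Finset.card_image_of_injOn fun M hM N hN h => ?_
    rw [← hxP M hM, ← hxP N hN, hinj _ _ (hxL M hM) (hxL N hN) h]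
  have hnot : Q.submodule ⊔ R.submodule ∉ (A.filter fun M => P.submodule ≤ M).image
      fun M => Q.submodule ⊔ (x M).submodule := by
    intro h
    obtain ⟨M, hM, e⟩ := Finset.mem_image.1 h
    have hMR : x M = R := hinj _ _ (hxL M hM) hRL e
    have hPM := hxP M hM
    rw [hMR] at hPM
    exact hPR (hPM ▸ (Finset.mem_filter.1 hM).1)
  have hle : insert (Q.submodule ⊔ R.submodule) ((A.filter fun M => P.submodule ≤ M).image
      fun M => Q.submodule ⊔ (x M).submodule) ⊆ A.filter fun M => Q.submodule ≤ M := by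
    refine Finset.insert_subset (hmem R hR hRL) ?_
    intro N hN
    obtain ⟨M, hM, rfl⟩ := Finset.mem_image.1 hN
    exact hmem _ (hxS M hM) (hxL M hM)
  have := Finset.card_le_card hle
  rw [Finset.card_insert_of_notMem hnot, hcard] at this
  exact this

lemma Supersolvable.isModular_of_multAt_eq_maxMult {A : Arr K} (hA : IsLineArr A)
    (hss : Supersolvable A) {P : Pt K} (hP : P ∈ SingSet A) (hmax : multAt A P = maxMult A) :
    IsModular A P := by
  obtain ⟨Q, hQ⟩ := hss
  by_contra h
  have h1 := hQ.multAt_lt hA hP h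
  have h2 := multAt_le_maxMult hQ.1
  omega

lemma multAt_filter_self (A : Arr K) (P : Pt K) :
    multAt (A.filter fun L => ¬ P.submodule ≤ L) P = 0 := by
  rw [multAt, Finset.card_eq_zero, Finset.filter_filter]
  exact Finset.filter_eq_empty_iff.2 fun L _ h => h.1 h.2

lemma IsModular.multAt_eq_add_one {A : Arr K} (hA : IsLineArr A) {P Q : Pt K}
    (hP : IsModular A P) (hQ : Q ∈ SingSet A) (hQP : Q ≠ P) :
    multAt A Q = multAt (A.filter fun L => ¬ P.submodule ≤ L) Q + 1 := by
  have hsplit := Finset.card_filter_add_card_filter_not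
    (s := A.filter fun L => Q.submodule ≤ L) (fun L => P.submodule ≤ L)
  have h1 : ((A.filter fun L => Q.submodule ≤ L).filter fun L => P.submodule ≤ L) =
      {P.submodule ⊔ Q.submodule} := by
    ext L
    simp only [Finset.mem_filter, Finset.mem_singleton]
    constructor
    · rintro ⟨⟨hL, hQL⟩, hPL⟩
      exact (Pt.sup_eq_line hQP.symm (hA L hL) hPL hQL).symm
    · rintro rfl
      exact ⟨⟨hP.2 Q hQ hQP, le_sup_right⟩, le_sup_left⟩
  rw [h1, Finset.card_singleton, Finset.filter_comm] at hsplit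
  rw [multAt, multAt, ← hsplit, add_comm]

lemma multAt_mono {A B : Arr K} (h : A ⊆ B) (P : Pt K) : multAt A P ≤ multAt B P :=
  Finset.card_le_card (Finset.filter_subset_filter _ h)

/-- The singular points of `A` are a modular point `P` of multiplicity at least 3, the simple
points, and the singular points of the arrangement of lines missing `P`. -/
lemma IsModular.ncard_singSet {A : Arr K} (hA : IsLineArr A) {P : Pt K}
    (hP : IsModular A P) (h3 : 3 ≤ multAt A P) :
    (SingSet A).ncard = (Sing2Set A).ncard +
      (SingSet (A.filter fun L => ¬ P.submodule ≤ L)).ncard + 1 := by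
  have hself := multAt_filter_self A P
  set B : Arr K := A.filter fun L => ¬ P.submodule ≤ L
  have hadd : ∀ Q ∈ SingSet A, Q ≠ P → multAt A Q = multAt B Q + 1 :=
    fun Q hQ hQP => hP.multAt_eq_add_one hA hQ hQP
  have hBA : SingSet B ⊆ SingSet A := fun Q hQ =>
    le_trans hQ (multAt_mono (Finset.filter_subset _ _) Q)
  have h2A : Sing2Set A ⊆ SingSet A := fun Q hQ => ge_of_eq hQ
  have hfin := singSet_finite hA
  have hPB : P ∉ SingSet B := fun h => by
    have : 2 ≤ multAt B P := h
    omega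
  have hP2 : P ∉ Sing2Set A := fun h => by
    have : multAt A P = 2 := h
    omega
  have hdisj : Disjoint (Sing2Set A) (SingSet B) := by
    refine Set.disjoint_left.2 fun Q hQ hQB => ?_
    have h1 : multAt A Q = 2 := hQ
    have h2 : 2 ≤ multAt B Q := hQB
    have := hadd Q (h2A hQ) (fun e => hP2 (e ▸ hQ))
    omega
  have hunion : SingSet A = insert P (Sing2Set A ∪ SingSet B) := by
    refine Set.Subset.antisymm (fun Q hQ => ?_)
      (Set.insert_subset hP.1 (Set.union_subset h2A hBA))
    by_cases hQP : Q = P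
    · exact Or.inl hQP
    · have h1 := hadd Q hQ hQP
      have h2 : 2 ≤ multAt A Q := hQ
      by_cases h : multAt A Q = 2
      · exact Or.inr (Or.inl h)
      · exact Or.inr (Or.inr (show 2 ≤ multAt B Q by omega))
  rw [hunion, Set.ncard_insert_of_notMem (fun h => h.elim hP2 hPB)
    ((hfin.subset h2A).union (hfin.subset hBA)),
    Set.ncard_union_eq hdisj (hfin.subset h2A) (hfin.subset hBA)]

end ProjectivePlane

/-- Over a field of characteristic 0, if `A` is a full rank supersolvable
line arrangement with `m(A) ≥ 3`, `P` a singular point of maximum multiplicity, and `A_h`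
the subarrangement of lines not through `P`, then
`|Sing₂(A)| = |Sing(A)| − |Sing(A_h)| − 1`. -/
theorem sing2_eq_sing_sub_singh {K : Type*} [Field K] [CharZero K] (A : Arr K)
    (hA : IsLineArr A) (hfr : FullRank A) (hss : Supersolvable A) (hm : 3 ≤ maxMult A)
    (P : Pt K) (hP : P ∈ SingSet A) (hPmax : multAt A P = maxMult A) :
    ((Sing2Set A).ncard : ℤ) =
      ((SingSet A).ncard : ℤ) -
        ((SingSet (A.filter fun L => ¬ P.submodule ≤ L)).ncard : ℤ) - 1 := by
  have hmod := hss.isModular_of_multAt_eq_maxMult hA hP hPmax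
  have := hmod.ncard_singSet hA (hPmax ▸ hm)
  omega
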